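/- For every m ≥ 3 and l ≥ 2, the chromatic symmetric function X_{D(m, l, 3)} of the dumbbell graph with one cycle replaced by a triangle is e-positive; this also holds for l ∈ {−1, 0, 1}. -/

import Mathlib

noncomputable section

open SimpleGraph

/-- The chromatic symmetric function of a finite simple graph, as a formal power
series in countably many commuting variables `x_0, x_1, x_2, …`: the coefficient of the
monomial `∏ i, x_i ^ d i` is the number of proper colourings `κ : V → ℕ` in which colour `i`
is used exactly `d i` times. -/
def csf {V : Type} [Fintype V] (G : SimpleGraph V) : MvPowerSeries ℕ ℚ :=
  fun d => (Nat.card {κ : V → ℕ //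
      (∀ u v : V, G.Adj u v → κ u ≠ κ v) ∧
      ∀ i : ℕ, Nat.card {v : V // κ v = i} = d i} : ℚ)

/-- The elementary symmetric function `e_k` as a formal power series. -/
def esym (k : ℕ) : MvPowerSeries ℕ ℚ :=
  fun d => if (∀ i ∈ d.support, d i = 1) ∧ (d.sum fun _ v => v) = k then 1 else 0

/-- `e_λ` for a partition `λ` given as a multiset of parts. -/
def esymM (μ : Multiset ℕ) : MvPowerSeries ℕ ℚ :=
  (μ.map esym).prod

/-- A symmetric function is `e`-positive if it is a finite nonnegative linear combination
of the elementary symmetric functions `e_λ`, `λ` a partition (all parts positive). -/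
def EPositive (f : MvPowerSeries ℕ ℚ) : Prop :=
  ∃ c : Multiset ℕ →₀ ℚ, (∀ μ, 0 ≤ c μ) ∧ (∀ μ ∈ c.support, 0 ∉ μ) ∧
    f = c.sum fun μ a => a • esymM μ

/-- The path `P_k` on `k` vertices. -/
def pathG (k : ℕ) : SimpleGraph (Fin k) :=
  SimpleGraph.fromRel (fun i j => (j : ℕ) = (i : ℕ) + 1)

/-- The cycle `C_m` on `m` vertices (for `m = 2` this is a single edge, i.e. `P_2`). -/
def cycleG (m : ℕ) : SimpleGraph (Fin m) :=
  SimpleGraph.fromRel (fun i j => (j : ℕ) = ((i : ℕ) + 1) % m)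

/-- Auxiliary relation for sun graphs: body relation on `Fin n`, plus rays
`P_{lam i}` attached at vertex `i`, the leaf `⟨i,0⟩` of ray `i` being joined to `i`. -/
def sunRel (n : ℕ) (lam : Fin n → ℕ) (body : Fin n → Fin n → Prop) :
    (Fin n ⊕ ((i : Fin n) × Fin (lam i))) → (Fin n ⊕ ((i : Fin n) × Fin (lam i))) → Prop
  | Sum.inl i, Sum.inl i' => body i i'
  | Sum.inl i, Sum.inr p => p.1 = i ∧ (p.2 : ℕ) = 0
  | Sum.inr p, Sum.inr q => p.1 = q.1 ∧ (q.2 : ℕ) = (p.2 : ℕ) + 1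
  | _, _ => False

/-- The sun graph `S(n; λ_1, …, λ_n)`: a cycle `C_n` with a path `P_{λ_i}` (a *ray*)
joined by an edge to the `i`-th cycle vertex, for each `i`. -/
def sunGraph (n : ℕ) (lam : Fin n → ℕ) :
    SimpleGraph (Fin n ⊕ ((i : Fin n) × Fin (lam i))) :=
  SimpleGraph.fromRel (sunRel n lam (fun i i' => (i' : ℕ) = ((i : ℕ) + 1) % n))

/-- The complete sun graph `S̄(n; λ_1, …, λ_n)`: as `sunGraph`, but with complete body `K_n`. -/
def completeSunGraph (n : ℕ) (lam : Fin n → ℕ) :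
    SimpleGraph (Fin n ⊕ ((i : Fin n) × Fin (lam i))) :=
  SimpleGraph.fromRel (sunRel n lam (fun i i' => i ≠ i'))

/-- The spider `S(μ_1, …, μ_d)`: `d` paths (legs) `P_{μ_i}`, each joined at a leaf to a
common centre vertex. -/
def spiderGraph (d : ℕ) (mu : Fin d → ℕ) :
    SimpleGraph (Unit ⊕ ((i : Fin d) × Fin (mu i))) :=
  SimpleGraph.fromRel (fun a b => match a, b with
    | Sum.inl _, Sum.inr p => (p.2 : ℕ) = 0
    | Sum.inr p, Sum.inr q => p.1 = q.1 ∧ (q.2 : ℕ) = (p.2 : ℕ) + 1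
    | _, _ => False)

/-- The graph obtained from a body graph `H` on `Fin n` by joining each body vertex `i`
by an edge to a chosen vertex `u i` of a graph `Gs i`. -/
def attachGraph {n : ℕ} {Vs : Fin n → Type} (H : SimpleGraph (Fin n))
    (Gs : ∀ i, SimpleGraph (Vs i)) (u : ∀ i, Vs i) :
    SimpleGraph (Fin n ⊕ ((i : Fin n) × Vs i)) :=
  SimpleGraph.fromRel (fun a b => match a, b with
    | Sum.inl i, Sum.inl i' => H.Adj i i'
    | Sum.inl i, Sum.inr p => p.1 = i ∧ p.2 = u p.1
    | Sum.inr p, Sum.inr q => ∃ h : p.1 = q.1, (Gs q.1).Adj (h ▸ p.2) q.2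
    | _, _ => False)

/-- `G` has a connected partition of type `μ`: a partition of the vertex set all of whose
blocks induce connected subgraphs, the multiset of block sizes being `μ`. -/
def HasConnectedPartition {V : Type} [Fintype V] [DecidableEq V]
    (G : SimpleGraph V) (μ : Multiset ℕ) : Prop :=
  ∃ P : Finpartition (Finset.univ : Finset V),
    (∀ p ∈ P.parts, (G.induce (↑p : Set V)).Connected) ∧
      P.parts.val.map Finset.card = μ

/-- `G` has a perfect matching: a partition of `V(G)` into pairs of adjacent vertices. -/
def HasPerfectMatching {V : Type} (G : SimpleGraph V) : Prop :=
  ∃ M : G.Subgraph, M.IsPerfectMatching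

/-- `G` has an almost perfect matching: a partition of `V(G)` into pairs of adjacent
vertices together with one singleton. -/
def HasAlmostPerfectMatching {V : Type} (G : SimpleGraph V) : Prop :=
  ∃ M : G.Subgraph, M.IsMatching ∧ ∃ v : V, M.verts = {v}ᶜ

/-- The tadpole graph `T_{m,l}`: the cycle `C_m` (vertices `0, …, m-1`, consecutive edges
plus the chord `{0, m-1}`) with a path on `l` further vertices attached by an edge at
vertex `m-1`.  For `l = 0` this is just `C_m`. -/
def tadpole (m l : ℕ) : SimpleGraph (Fin (m + l)) :=
  SimpleGraph.fromRel (fun i j =>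
    (j : ℕ) = (i : ℕ) + 1 ∨ ((i : ℕ) = 0 ∧ (j : ℕ) = m - 1))

/-- Dumbbell with path-parameter `t = l + 1 ≥ 0`: vertices `0, …, m-1` form the cycle `C_m`
(consecutive edges plus chord `{0, m-1}`), vertices `m+t-1, …, m+n+t-2` form the cycle `C_n`
(consecutive edges plus chord `{m+t-1, m+n+t-2}`), and the vertices in between form the
connecting path; for `t = 0` (i.e. `l = -1`) the two cycles share the vertex `m-1`. -/
def dumbbellAux (m n t : ℕ) : SimpleGraph (Fin (m + n + t - 1)) :=
  SimpleGraph.fromRel (fun i j =>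
    (j : ℕ) = (i : ℕ) + 1
      ∨ ((i : ℕ) = 0 ∧ (j : ℕ) = m - 1)
      ∨ ((i : ℕ) = m + t - 1 ∧ (j : ℕ) = m + n + t - 2))

/-- The dumbbell graph `D(m, l, n)` for `l ≥ -1`: cycles `C_m` and `C_n` joined by a path
on `l` vertices (for `l = 1` a single joining vertex, for `l = 0` a joining edge, and for
`l = -1` the two cycles share a vertex). -/
def dumbbell (m n : ℕ) (l : ℤ) : SimpleGraph (Fin (m + n + (l + 1).toNat - 1)) :=
  dumbbellAux m n (l + 1).toNat

end

section Series
open PowerSeries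

variable {A : Type*} [CommRing A]

/-- The coefficients of the inverse of `∑ (1 - k) e_k z^k`. -/
def invSeq (e : ℕ → A) : ℕ → A
  | 0 => 1
  | n + 1 => ∑ j : Fin (n + 1), (j : A) * (e (j + 1) * invSeq e (n - j))
decreasing_by omega

/-- The coefficients of the series `H` with `F H = (m - 1) - ∑_{0 < i < m} X_{C_i} z^i`,
where `F = ∑ (1 - k) e_k z^k`. -/
def truncSeq (e : ℕ → A) (m : ℕ) : ℕ → A
  | 0 => ((m - 1 : ℕ) : A)
  | n + 1 =>
    if n + 1 < m then ((m - 1 - (n + 1) : ℕ) : A) * invSeq e (n + 1)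
    else ∑ j : Fin (n + 1), (j : A) * (e (j + 1) * truncSeq e m (n - j))
decreasing_by omega

/-- The coefficients of `z E' (1 + e_1 z + e_2 z²) - E (e_1 z + 2 e_2 z²)`. -/
def triSeq (e : ℕ → A) : ℕ → A
  | 0 => 0
  | 1 => 0
  | 2 => 0
  | 3 => 3 * e 3
  | k + 4 => ((k + 4 : ℕ) : A) * e (k + 4) + ((k + 2 : ℕ) : A) * (e 1 * e (k + 3)) +
      (k : A) * (e 2 * e (k + 2))

/-- The expansion in the `e_k` of the chromatic symmetric function of the dumbbell formed by `C_m`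
and a triangle on `N` vertices. -/
def dumbbellSeq (e : ℕ → A) (m N : ℕ) : A :=
  2 * ∑ p ∈ Finset.HasAntidiagonal.antidiagonal N, triSeq e p.1 * truncSeq e m p.2

theorem map_invSeq {B : Type*} [CommRing B] (φ : A →+* B) (e : ℕ → A) (n : ℕ) :
    φ (invSeq e n) = invSeq (fun k => φ (e k)) n := by
  induction n using Nat.strong_induction_on with
  | _ n ih =>
    cases n with
    | zero => simp [invSeq]
    | succ n =>
      rw [invSeq, invSeq, map_sum]
      refine Finset.sum_congr rfl fun j _ => ?_
      rw [map_mul, map_mul, map_natCast, ih _ (by omega)]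

theorem map_truncSeq {B : Type*} [CommRing B] (φ : A →+* B) (e : ℕ → A) (m n : ℕ) :
    φ (truncSeq e m n) = truncSeq (fun k => φ (e k)) m n := by
  induction n using Nat.strong_induction_on with
  | _ n ih =>
    cases n with
    | zero => simp [truncSeq]
    | succ n =>
      rw [truncSeq, truncSeq]
      split_ifs with h
      · rw [map_mul, map_natCast, map_invSeq]
      · rw [map_sum]
        refine Finset.sum_congr rfl fun j _ => ?_
        rw [map_mul, map_mul, map_natCast, ih _ (by omega)]

theorem map_triSeq {B : Type*} [CommRing B] (φ : A →+* B) (e : ℕ → A) (n : ℕ) :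
    φ (triSeq e n) = triSeq (fun k => φ (e k)) n := by
  rcases n with _ | _ | _ | _ | n <;> simp [triSeq, map_ofNat φ]

theorem map_dumbbellSeq {B : Type*} [CommRing B] (φ : A →+* B) (e : ℕ → A) (m N : ℕ) :
    φ (dumbbellSeq e m N) = dumbbellSeq (fun k => φ (e k)) m N := by
  simp [dumbbellSeq, map_triSeq, map_truncSeq, map_ofNat φ]

theorem coeff_X_mul_derivative (f : A⟦X⟧) (n : ℕ) :
    coeff n (X * d⁄dX A f) = n * coeff n f := by
  cases n with
  | zero => simp
  | succ n => rw [coeff_succ_X_mul, coeff_derivative]; push_cast; ring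

/-- If `(E - z E') H = V` with `E = ∑ e_k z^k`, `e_0 = 1`, then the coefficients of `H` satisfy a
linear recurrence. -/
theorem coeff_of_mul_eq {E H V : A⟦X⟧} {e : ℕ → A} (hE : E = mk e) (h0 : e 0 = 1)
    (h : (E - X * d⁄dX A E) * H = V) (n : ℕ) :
    coeff (n + 1) H = coeff (n + 1) V +
      ∑ j : Fin (n + 1), (j : A) * (e (j + 1) * coeff (n - j) H) := by
  have hn := congrArg (coeff (n + 1)) h
  rw [coeff_mul, Finset.Nat.sum_antidiagonal_eq_sum_range_succ
    (fun i j => coeff i (E - X * d⁄dX A E) * coeff j H), Finset.sum_range_succ'] at hn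
  rw [← hn, Finset.sum_range, add_right_comm, ← Finset.sum_add_distrib, Finset.sum_eq_zero]
  · simp [hE, h0]
  · intro j _
    rw [map_sub, coeff_X_mul_derivative, hE, coeff_mk, Nat.add_sub_add_right]
    push_cast
    ring

theorem coeff_inv_eq_invSeq {E G : A⟦X⟧} {e : ℕ → A} (hE : E = mk e) (h0 : e 0 = 1)
    (h : (E - X * d⁄dX A E) * G = 1) (n : ℕ) : coeff n G = invSeq e n := by
  induction n using Nat.strong_induction_on with
  | _ n ih =>
    cases n with
    | zero =>
      have := congrArg (coeff 0) h
      simpa [coeff_mul, invSeq, hE, h0] using this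
    | succ n =>
      rw [coeff_of_mul_eq hE h0 h, invSeq, coeff_one, if_neg (by omega), zero_add]
      refine Finset.sum_congr rfl fun j _ => ?_
      rw [ih _ (by omega)]

theorem coeff_eq_truncSeq {E G C H V : A⟦X⟧} {e : ℕ → A} {m : ℕ} (hm : 1 ≤ m)
    (hE : E = mk e) (h0 : e 0 = 1)
    (hG : (E - X * d⁄dX A E) * G = 1) (hC : C * G = X * d⁄dX A G)
    (hV : ∀ i, coeff i V = if i = 0 then (m : A) - 1 else if i < m then - coeff i C else 0)
    (hC0 : coeff 0 C = 0) (hH : H = G * V) (n : ℕ) : coeff n H = truncSeq e m n := by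
  have hFH : (E - X * d⁄dX A E) * H = V := by rw [hH, ← mul_assoc, hG, one_mul]
  have hsmall (n : ℕ) (hn : n < m) : coeff n H = ((m - 1 - n : ℕ) : A) * invSeq e n := by
    have h1 := congrArg (coeff n) hC
    rw [coeff_X_mul_derivative, coeff_inv_eq_invSeq hE h0 hG] at h1
    have h2 : coeff n H = coeff n (PowerSeries.C ((m : A) - 1) * G) - coeff n (C * G) := by
      rw [hH, mul_comm G, coeff_mul, coeff_mul, coeff_mul, ← Finset.sum_sub_distrib]
      refine Finset.sum_congr rfl fun p hp => ?_
      have := Finset.HasAntidiagonal.mem_antidiagonal.1 hp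
      rw [hV, ← sub_mul]
      congr 1
      rw [coeff_C]
      split_ifs with h h'
      · rw [h, hC0, sub_zero]
      · rw [zero_sub]
      · omega
    rw [h2, h1, coeff_C_mul, coeff_inv_eq_invSeq hE h0 hG, ← sub_mul]
    congr 1
    rw [Nat.sub_sub, Nat.cast_sub (by omega)]
    push_cast
    ring
  induction n using Nat.strong_induction_on with
  | _ n ih =>
    cases n with
    | zero => simp [hsmall 0 hm, truncSeq, invSeq]
    | succ n =>
      rw [truncSeq]
      split_ifs with h
      · exact hsmall _ h
      · rw [coeff_of_mul_eq hE h0 hFH, hV, if_neg (by omega), if_neg h, zero_add]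
        refine Finset.sum_congr rfl fun j _ => ?_
        rw [ih _ (by omega)]

theorem coeff_eq_triSeq {E : A⟦X⟧} {e : ℕ → A} (hE : E = mk e) (h0 : e 0 = 1) (n : ℕ) :
    coeff n ((1 - X * (X * PowerSeries.C (e 2))) * E -
      (1 + X * PowerSeries.C (e 1) + X * (X * PowerSeries.C (e 2))) * (E - X * d⁄dX A E)) =
      triSeq e n := by
  have key (n : ℕ) : coeff n (E - X * d⁄dX A E) = (1 - n) * e n := by
    rw [map_sub, coeff_X_mul_derivative, hE, coeff_mk]; ring
  have hc (n : ℕ) : coeff n E = e n := by rw [hE, coeff_mk]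
  rcases n with _ | _ | _ | _ | n
  all_goals
    simp only [sub_mul, add_mul, one_mul, mul_assoc, map_sub, map_add, coeff_succ_X_mul,
      coeff_zero_X_mul, coeff_C_mul, triSeq, key, hc, h0]
    push_cast
    ring

/-- The algebraic core: the coefficients of `s V`, combined as dictated by the triangle, are given
by the manifestly positive expression `dumbbellSeq`. -/
theorem dumbbellSeq_eq {E s C : A⟦X⟧} {e : ℕ → A} {m t : ℕ} (hm : 1 ≤ m)
    (hE : E = mk e) (h0 : e 0 = 1) (hs : s * (E - X * d⁄dX A E) = E)
    (hC : C * s = X * d⁄dX A s - s + 1) (hC0 : coeff 0 C = 0) (V : A⟦X⟧)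
    (hV : ∀ i, coeff i V = if i = 0 then (m : A) - 1 else if i < m then - coeff i C else 0) :
    2 * (coeff (m + t + 2) (s * V) - e 2 * coeff (m + t) (s * V)) =
      dumbbellSeq e m (m + t + 2) := by
  have hEu : IsUnit E := by
    rw [PowerSeries.isUnit_iff_constantCoeff, ← coeff_zero_eq_constantCoeff_apply, hE, coeff_mk, h0]
    exact isUnit_one
  have hFu : IsUnit (E - X * d⁄dX A E) := by
    rw [PowerSeries.isUnit_iff_constantCoeff, ← coeff_zero_eq_constantCoeff_apply, map_sub,
      coeff_zero_X_mul, hE, coeff_mk, h0, sub_zero]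
    exact isUnit_one
  obtain ⟨G, hG⟩ := hFu.exists_right_inv
  have hds := congrArg (d⁄dX A) hs
  have hdG := congrArg (d⁄dX A) hG
  simp only [Derivation.leibniz, map_sub, smul_eq_mul, Derivation.map_one_eq_zero, derivative_X]
    at hds hdG
  have hsG : s = E * G := by linear_combination (-s) * hG + G * hs
  have hCG : C * G = X * d⁄dX A G := by
    refine hEu.mul_left_cancel ?_
    have h1 : d⁄dX A s = d⁄dX A E * G + E * d⁄dX A G := by
      rw [hsG, Derivation.leibniz, smul_eq_mul, smul_eq_mul]; ring
    rw [h1, hsG] at hC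
    linear_combination hC - hG
  have htri : (1 - X * (X * PowerSeries.C (e 2))) * s =
      ((1 - X * (X * PowerSeries.C (e 2))) * E -
      (1 + X * PowerSeries.C (e 1) + X * (X * PowerSeries.C (e 2))) * (E - X * d⁄dX A E)) * G +
      (1 + X * PowerSeries.C (e 1) + X * (X * PowerSeries.C (e 2))) := by
    rw [hsG]
    linear_combination
      (1 + X * PowerSeries.C (e 1) + X * (X * PowerSeries.C (e 2))) * hG
  have hlhs : coeff (m + t + 2) (s * V) - e 2 * coeff (m + t) (s * V) =
      coeff (m + t + 2) (((1 - X * (X * PowerSeries.C (e 2))) * s) * V) := by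
    simp only [sub_mul, one_mul, mul_assoc, map_sub, coeff_succ_X_mul, coeff_C_mul]
  rw [hlhs, htri, add_mul, map_add, dumbbellSeq, mul_assoc, coeff_mul]
  have hlow : coeff (m + t + 2)
      ((1 + X * PowerSeries.C (e 1) + X * (X * PowerSeries.C (e 2))) * V) = 0 := by
    simp only [add_mul, one_mul, mul_assoc, map_add, coeff_succ_X_mul, coeff_C_mul, hV]
    simp [show ¬ (m + t + 2 < m) by omega, show ¬ (m + t + 1 < m) by omega,
      show m ≠ 0 by omega]
  rw [hlow, add_zero]
  congr 1
  refine Finset.sum_congr rfl fun p _ => ?_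
  rw [coeff_eq_triSeq hE h0, coeff_eq_truncSeq hm hE h0 hG hCG hV hC0 rfl]

end Series

section Transfer
open PowerSeries

variable {A : Type*} [CommRing A] {ι : Type*} [Fintype ι] [DecidableEq ι]

/-- The transfer operator `(L g)(c) = ∑_{b ≠ c} x_b g(b)` of proper colourings of a path. -/
def transfer (x : ι → A) : Module.End A (ι → A) where
  toFun g c := ∑ a, x a * g a - x c * g c
  map_add' g h := by
    ext c
    simp only [Pi.add_apply, mul_add, Finset.sum_add_distrib]
    ring
  map_smul' r g := by
    ext c
    simp only [Pi.smul_apply, smul_eq_mul, RingHom.id_apply, mul_sub, Finset.mul_sum]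
    congr 1
    · exact Finset.sum_congr rfl fun _ _ => by ring
    · ring

omit [DecidableEq ι] in
theorem transfer_apply (x g : ι → A) (c : ι) :
    transfer x g c = ∑ a, x a * g a - x c * g c := rfl

theorem transfer_apply_eq_sum (x g : ι → A) (c : ι) :
    transfer x g c = ∑ a, if c ≠ a then x a * g a else 0 := by
  rw [transfer_apply, ← Finset.sum_filter, sub_eq_iff_eq_add,
    ← Finset.sum_filter_add_sum_filter_not Finset.univ (fun a => c ≠ a)]
  simp [Finset.filter_eq]

omit [DecidableEq ι] in
theorem transfer_pow_succ_apply (x g : ι → A) (n : ℕ) (c : ι) :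
    (transfer x ^ (n + 1)) g c =
      ∑ a, x a * (transfer x ^ n) g a - x c * (transfer x ^ n) g c := by
  rw [pow_succ', Module.End.mul_apply, transfer_apply]

omit [DecidableEq ι] in
theorem sum_mul_transfer (x g h : ι → A) :
    ∑ a, x a * (transfer x g a * h a) = ∑ a, x a * (g a * transfer x h a) := by
  simp only [transfer_apply, sub_mul, mul_sub, Finset.sum_sub_distrib]
  congr 1
  · simp only [← mul_assoc, ← Finset.sum_mul, mul_right_comm _ (∑ a, x a * g a)]
    rw [mul_comm]
  · exact Finset.sum_congr rfl fun _ _ => by ring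

omit [DecidableEq ι] in
theorem sum_mul_transfer_pow (x g h : ι → A) (n : ℕ) :
    ∑ a, x a * ((transfer x ^ n) g a * h a) = ∑ a, x a * (g a * (transfer x ^ n) h a) := by
  induction n generalizing h with
  | zero => simp
  | succ n ih =>
    rw [pow_succ', Module.End.mul_apply, sum_mul_transfer, ih, ← Module.End.mul_apply, ← pow_succ,
      pow_succ']

/-- The chromatic symmetric polynomials of paths. -/
def pathPoly (x : ι → A) : ℕ → A
  | 0 => 1
  | n + 1 => ∑ a, x a * (transfer x ^ n) 1 a

/-- Weighted count of closed proper walks of length `m` starting at colour `a`. -/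
def closedWalk (x : ι → A) (m : ℕ) (a : ι) : A := (transfer x ^ m) (Pi.single a 1) a

/-- The chromatic symmetric polynomials of cycles with a pendant path. -/
def tadpolePoly (x : ι → A) (m l : ℕ) : A := ∑ a, closedWalk x m a * (transfer x ^ l) 1 a

theorem closedWalk_zero (x : ι → A) (a : ι) : closedWalk x 0 a = 1 := by
  simp [closedWalk]

theorem closedWalk_succ (x : ι → A) (m : ℕ) (a : ι) :
    closedWalk x (m + 1) a = x a * ((transfer x ^ m) 1 a - closedWalk x m a) := by
  have h : transfer x (Pi.single a 1) = x a • ((1 : ι → A) - Pi.single a 1) := by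
    ext c
    rw [transfer_apply]
    by_cases hc : c = a
    · subst hc
      simp [Pi.single_apply]
    · simp [Pi.single_apply, hc]
  rw [closedWalk, pow_succ, Module.End.mul_apply, h, map_smul, map_sub]
  rfl

theorem tadpolePoly_one (x : ι → A) (l : ℕ) : tadpolePoly x 1 l = 0 := by
  simp [tadpolePoly, closedWalk_succ, closedWalk_zero]

theorem tadpolePoly_succ (x : ι → A) (m l : ℕ) :
    tadpolePoly x (m + 1) l =
      tadpolePoly x m (l + 1) +
        (pathPoly x (m + l + 1) - tadpolePoly x m 0 * pathPoly x (l + 1)) := by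
  have h1 : pathPoly x (m + l + 1) =
      ∑ a, x a * ((transfer x ^ m) 1 a * (transfer x ^ l) 1 a) := by
    rw [sum_mul_transfer_pow, ← Module.End.mul_apply, ← pow_add]
    simp [pathPoly]
  rw [h1]
  simp only [tadpolePoly, closedWalk_succ, transfer_pow_succ_apply, pathPoly, mul_sub, sub_mul,
    Finset.sum_sub_distrib, pow_zero, Module.End.one_apply, Pi.one_apply, mul_one, Finset.sum_mul]
  have h2 : ∑ a, x a * closedWalk x m a * (transfer x ^ l) 1 a =
      ∑ a, closedWalk x m a * (x a * (transfer x ^ l) 1 a) :=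
    Finset.sum_congr rfl fun _ _ => by ring
  rw [h2]
  simp only [mul_assoc]
  ring

theorem tadpolePoly_eq_sum (x : ι → A) (m l : ℕ) :
    tadpolePoly x (m + 1) l = ∑ i ∈ Finset.range m,
      (pathPoly x (m + l + 1) - tadpolePoly x (i + 1) 0 * pathPoly x (m + l - i)) := by
  induction m generalizing l with
  | zero => simp [tadpolePoly_one]
  | succ m ih =>
    rw [tadpolePoly_succ, ih, Finset.sum_range_succ]
    congr 1
    · refine Finset.sum_congr rfl fun i _ => ?_
      rw [show m + (l + 1) = m + 1 + l by ring]
    · rw [show m + 1 + l - m = l + 1 by omega]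

/-- The generating function of the elementary symmetric polynomials. -/
noncomputable def elemSeries (x : ι → A) : A⟦X⟧ := ∏ a, (1 + PowerSeries.C (x a) * X)

/-- The elementary symmetric polynomial `e_k(x)`. -/
def elemPoly (x : ι → A) (k : ℕ) : A := ∑ t ∈ Finset.univ.powersetCard k, ∏ a ∈ t, x a

omit [DecidableEq ι] in
theorem elemSeries_eq (x : ι → A) : elemSeries x = mk (elemPoly x) := by
  ext k
  rw [elemSeries, Finset.prod_one_add, map_sum, coeff_mk, elemPoly,
    Finset.powersetCard_eq_filter, Finset.sum_filter]
  refine Finset.sum_congr rfl fun t _ => ?_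
  rw [Finset.prod_mul_distrib, Finset.prod_const, ← map_prod, coeff_C_mul, coeff_X_pow, mul_ite,
    mul_one, mul_zero]
  simp only [eq_comm]

omit [DecidableEq ι] in
theorem elemPoly_zero (x : ι → A) : elemPoly x 0 = 1 := by
  simp [elemPoly]

theorem derivative_elemSeries (x : ι → A) :
    d⁄dX A (elemSeries x) =
      ∑ a, PowerSeries.C (x a) * ∏ b ∈ Finset.univ.erase a, (1 + PowerSeries.C (x b) * X) := by
  suffices h : ∀ s : Finset ι, d⁄dX A (∏ a ∈ s, (1 + PowerSeries.C (x a) * X)) =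
      ∑ a ∈ s, PowerSeries.C (x a) * ∏ b ∈ s.erase a, (1 + PowerSeries.C (x b) * X) from
    h Finset.univ
  intro s
  induction s using Finset.induction_on with
  | empty => simp
  | insert c s hc ih =>
    rw [Finset.prod_insert hc, Derivation.leibniz, ih, Finset.sum_insert hc,
      Finset.erase_insert hc, add_comm, smul_eq_mul, smul_eq_mul, Finset.mul_sum]
    congr 1
    · simp [Derivation.leibniz, mul_comm]
    · refine Finset.sum_congr rfl fun a ha => ?_
      have hac : a ≠ c := fun h => hc (h ▸ ha)
      rw [Finset.erase_insert_of_ne hac.symm,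
        Finset.prod_insert fun h => hc (Finset.mem_of_mem_erase h)]
      ring

theorem pathPoly_series_mul (x : ι → A) :
    mk (pathPoly x) * (elemSeries x - X * d⁄dX A (elemSeries x)) = elemSeries x := by
  set Φ : ι → A⟦X⟧ := fun c => mk fun l => (transfer x ^ l) 1 c with hΦ
  have h1 (c : ι) : (1 + PowerSeries.C (x c) * X) * Φ c = mk (pathPoly x) := by
    ext n
    rw [add_mul, one_mul, mul_assoc, map_add, coeff_C_mul]
    cases n with
    | zero => simp [hΦ, pathPoly]
    | succ n =>
      rw [coeff_succ_X_mul, coeff_mk, coeff_mk, coeff_mk, transfer_pow_succ_apply, pathPoly,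
        sub_add_cancel]
  have h2 : mk (pathPoly x) = 1 + X * ∑ c, PowerSeries.C (x c) * Φ c := by
    ext n
    cases n with
    | zero => simp [pathPoly]
    | succ n => simp [coeff_succ_X_mul, coeff_one, pathPoly, hΦ]
  have h3 : mk (pathPoly x) * d⁄dX A (elemSeries x) =
      elemSeries x * ∑ c, PowerSeries.C (x c) * Φ c := by
    rw [derivative_elemSeries, Finset.mul_sum, Finset.mul_sum]
    refine Finset.sum_congr rfl fun c _ => ?_
    rw [← h1 c, elemSeries, ← Finset.mul_prod_erase _ _ (Finset.mem_univ c)]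
    ring
  linear_combination (-X) * h3 + elemSeries x * h2

/-- The power series `∑_{m ≥ 1} X_{C_m} z^m`. -/
noncomputable def cycleSeries (x : ι → A) : A⟦X⟧ :=
  mk fun m => if m = 0 then 0 else tadpolePoly x m 0

theorem cycleSeries_mul (x : ι → A) :
    cycleSeries x * mk (pathPoly x) =
      X * d⁄dX A (mk (pathPoly x)) - mk (pathPoly x) + 1 := by
  ext n
  rw [coeff_mul, Finset.Nat.sum_antidiagonal_eq_sum_range_succ
    (fun i j => coeff i (cycleSeries x) * coeff j (mk (pathPoly x))), Finset.sum_range_succ']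
  cases n with
  | zero => simp [cycleSeries, pathPoly]
  | succ n =>
    have h := tadpolePoly_eq_sum x n 0
    rw [Finset.sum_sub_distrib] at h
    simp only [cycleSeries, coeff_mk, if_true, zero_mul, add_zero, map_add, map_sub,
      coeff_succ_X_mul, coeff_derivative, coeff_one, Finset.sum_range_succ, Nat.succ_ne_zero,
      if_false, Nat.sub_self, Nat.add_sub_add_right]
    simp only [Finset.sum_const, Finset.card_range, nsmul_eq_mul, add_zero] at h
    rw [h]
    simp only [pathPoly]
    ring

theorem coeff_pathPoly_series_mul (x : ι → A) (m l : ℕ) (V : A⟦X⟧)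
    (hV : ∀ i, coeff i V =
      if i = 0 then ((m + 1 : ℕ) : A) - 1 else if i < m + 1 then - coeff i (cycleSeries x) else 0) :
    coeff (m + 1 + l) (mk (pathPoly x) * V) = tadpolePoly x (m + 1) l := by
  rw [tadpolePoly_eq_sum, mul_comm, coeff_mul, Finset.Nat.sum_antidiagonal_eq_sum_range_succ
    (fun i j => coeff i V * coeff j (mk (pathPoly x))), Finset.sum_range_succ',
    show m + 1 + l = m + (l + 1) by ring, Finset.sum_range_add, Finset.sum_sub_distrib]
  rw [Finset.sum_eq_zero (s := Finset.range (l + 1))]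
  · simp only [hV, coeff_mk, Finset.sum_const, Finset.card_range, nsmul_eq_mul]
    rw [add_zero, if_pos trivial, add_comm, sub_eq_add_neg ((m : A) * _), ← Finset.sum_neg_distrib]
    congr 1
    · push_cast
      rw [show m + (l + 1) - 0 = m + l + 1 by omega]
      ring
    · refine Finset.sum_congr rfl fun i hi => ?_
      have := Finset.mem_range.1 hi
      rw [if_neg (by omega), if_pos (by omega), cycleSeries, coeff_mk, if_neg (by omega),
        show m + (l + 1) - (i + 1) = m + l - i by omega]
      ring
  · intro i _
    rw [hV, if_neg (by omega), if_neg (by omega), zero_mul]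

theorem tadpolePoly_sub_eq_dumbbellSeq (x : ι → A) (m t : ℕ) :
    2 * (tadpolePoly x (m + 1) (t + 2) - elemPoly x 2 * tadpolePoly x (m + 1) t) =
      dumbbellSeq (elemPoly x) (m + 1) (m + 1 + t + 2) := by
  have hV (i : ℕ) : coeff i (mk fun i => if i = 0 then ((m + 1 : ℕ) : A) - 1
      else if i < m + 1 then - coeff i (cycleSeries x) else 0) =
      if i = 0 then ((m + 1 : ℕ) : A) - 1
      else if i < m + 1 then - coeff i (cycleSeries x) else 0 := coeff_mk _ _
  rw [← dumbbellSeq_eq (Nat.succ_pos m) (elemSeries_eq x) (elemPoly_zero x)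
    (pathPoly_series_mul x) (cycleSeries_mul x) (by simp [cycleSeries]) _ hV, add_assoc,
    coeff_pathPoly_series_mul x m _ _ hV, coeff_pathPoly_series_mul x m _ _ hV]

theorem pathPoly_two (x : ι → A) : pathPoly x 2 = 2 * elemPoly x 2 := by
  have h := congrArg (coeff 2) (pathPoly_series_mul x)
  rw [elemSeries_eq, mul_sub, ← mul_assoc, mul_comm _ X, mul_assoc, map_sub,
    coeff_succ_X_mul] at h
  simp [coeff_mul, Finset.Nat.antidiagonal_succ, coeff_derivative, pathPoly, elemPoly_zero] at h
  simp [pathPoly]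
  linear_combination h

/-- Triple deletion: the two remaining vertices of a triangle hanging at a vertex of colour `c`. -/
theorem sum_triangle (x : ι → A) (c : ι) :
    (∑ a, ∑ b, if c ≠ a ∧ c ≠ b ∧ a ≠ b then x a * x b else 0) =
      2 * (transfer x ^ 2) 1 c - 2 * elemPoly x 2 := by
  have h (a : ι) : (∑ b, if c ≠ a ∧ c ≠ b ∧ a ≠ b then x a * x b else 0) =
      if c ≠ a then x a * (transfer x 1 a - x c) else 0 := by
    split_ifs with hca
    · rw [transfer_apply_eq_sum, ← Finset.add_sum_erase _ _ (Finset.mem_univ c),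
        ← Finset.add_sum_erase _ _ (Finset.mem_univ c), if_neg (by simp), if_pos (Ne.symm hca),
        zero_add, Pi.one_apply, mul_one, add_sub_cancel_left, Finset.mul_sum]
      refine Finset.sum_congr rfl fun b hb => ?_
      simp [hca, (Finset.ne_of_mem_erase hb).symm]
    · exact Finset.sum_eq_zero fun b _ => if_neg fun h => hca h.1
  have h2 : ∑ a, x a * transfer x 1 a = 2 * elemPoly x 2 := by
    rw [← pathPoly_two]; simp [pathPoly]
  have h3 : ∑ a, x a * (transfer x 1 a - x c) = 2 * elemPoly x 2 - x c * ∑ a, x a := by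
    rw [← h2, Finset.mul_sum, ← Finset.sum_sub_distrib]
    exact Finset.sum_congr rfl fun _ _ => by ring
  have h4 := transfer_apply_eq_sum x (fun a => transfer x 1 a - x c) c
  rw [transfer_apply, h3] at h4
  simp only [h]
  rw [← h4, pow_two, Module.End.mul_apply, transfer_apply x (transfer x 1), h2,
    transfer_apply x 1]
  simp only [Pi.one_apply, mul_one]
  ring

theorem sum_mul_transfer_pow_ne (x g : ι → A) (m : ℕ) :
    ∑ a, x a * (transfer x ^ m) (fun c => if a ≠ c then g c else 0) a =
      ∑ a, closedWalk x (m + 1) a * g a := by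
  have h (a : ι) : (fun c => if a ≠ c then g c else 0) = g - g a • Pi.single a 1 := by
    ext c
    by_cases hc : a = c
    · subst hc; simp
    · simp [hc, Ne.symm hc]
  have h2 : ∑ a, x a * (transfer x ^ m) g a = ∑ a, x a * ((transfer x ^ m) 1 a * g a) := by
    rw [sum_mul_transfer_pow]; simp
  simp only [h, map_sub, map_smul, closedWalk_succ, Pi.sub_apply, Pi.smul_apply, mul_sub, sub_mul,
    Finset.sum_sub_distrib, h2, smul_eq_mul]
  congr 1
  · exact Finset.sum_congr rfl fun _ _ => by ring
  · exact Finset.sum_congr rfl fun _ _ => by rw [closedWalk]; ring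

end Transfer

section Colourings

open scoped Classical in
/-- The sum, over the `r`-proper colourings `κ` of `0, …, n`, of the monomial of `κ` weighted
by `Φ κ`. -/
noncomputable def colourSum {A : Type*} [CommRing A] {ι : Type*} [Fintype ι] (x : ι → A)
    (r : ℕ → ℕ → Prop) (n : ℕ) (Φ : (Fin (n + 1) → ι) → A) : A :=
  ∑ κ : Fin (n + 1) → ι,
    if ∀ i j : Fin (n + 1), r i j → κ i ≠ κ j then (∏ v, x (κ v)) * Φ κ else 0

variable {A : Type*} [CommRing A] {ι : Type*} [Fintype ι] [DecidableEq ι] (x : ι → A)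
  {r : ℕ → ℕ → Prop}

open scoped Classical in
theorem colourSum_succ (hr : ∀ i j, r i j → i < j) (n : ℕ) (Φ : (Fin (n + 2) → ι) → A) :
    colourSum x r (n + 1) Φ = colourSum x r n fun κ =>
      ∑ c, if ∀ i : Fin (n + 1), r i (n + 1) → κ i ≠ c then
        x c * Φ (Fin.snoc (α := fun _ => ι) κ c) else 0 := by
  have key (κ : Fin (n + 1) → ι) (c : ι) :
      (∀ i j : Fin (n + 2), r i j → Fin.snoc (α := fun _ => ι) κ c i ≠
        Fin.snoc (α := fun _ => ι) κ c j) ↔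
      (∀ i j : Fin (n + 1), r i j → κ i ≠ κ j) ∧
        ∀ i : Fin (n + 1), r i (n + 1) → κ i ≠ c := by
    constructor
    · intro h
      refine ⟨fun i j hij => ?_, fun i hi => ?_⟩
      · simpa using h i.castSucc j.castSucc hij
      · simpa using h i.castSucc (Fin.last _) hi
    · rintro ⟨h1, h2⟩ i j
      refine Fin.lastCases ?_ (fun j => ?_) j <;> refine Fin.lastCases ?_ (fun i => ?_) i
      · intro h; exact absurd (hr _ _ h) (lt_irrefl _)
      · intro h; simpa using h2 i h
      · intro h
        have := hr _ _ h
        simp only [Fin.val_last, Fin.val_castSucc] at this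
        omega
      · intro h; simpa using h1 i j h
  rw [colourSum, colourSum, ← (Fin.snocEquiv fun _ => ι).sum_comp, Fintype.sum_prod_type_right]
  refine Finset.sum_congr rfl fun κ _ => ?_
  simp only [Fin.snocEquiv_apply, key]
  split_ifs with h
  · rw [Finset.mul_sum]
    refine Finset.sum_congr rfl fun c _ => ?_
    simp only [and_iff_right h, Fin.prod_univ_castSucc, Fin.snoc_castSucc, Fin.snoc_last,
      mul_ite, mul_zero, mul_assoc]
    rfl
  · simp [h]

omit [Fintype ι] [DecidableEq ι] in
theorem snoc_zero_eq {n : ℕ} (κ : Fin (n + 1) → ι) (c : ι) :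
    Fin.snoc (α := fun _ => ι) κ c 0 = κ 0 := by
  rw [← Fin.castSucc_zero, Fin.snoc_castSucc]

theorem colourSum_path_step (hr : ∀ i j, r i j → i < j) {n : ℕ}
    (hn : ∀ i, r i (n + 1) ↔ i = n) (h : ι → ι → A) :
    colourSum x r (n + 1) (fun κ => h (κ 0) (κ (Fin.last _))) =
      colourSum x r n fun κ => transfer x (h (κ 0)) (κ (Fin.last _)) := by
  rw [colourSum_succ x hr]
  congr 1
  ext κ
  rw [transfer_apply_eq_sum]
  refine Finset.sum_congr rfl fun c _ => ?_
  have : (∀ i : Fin (n + 1), r i (n + 1) → κ i ≠ c) ↔ κ (Fin.last n) ≠ c :=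
    ⟨fun h => h _ ((hn _).2 rfl), fun h i hi => by
      rwa [show i = Fin.last n from Fin.ext ((hn _).1 hi)]⟩
  simp only [this, snoc_zero_eq, Fin.snoc_last]

theorem colourSum_chord_step (hr : ∀ i j, r i j → i < j) {n : ℕ}
    (hn : ∀ i, r i (n + 1) ↔ i = n ∨ i = 0) (h : ι → ι → A) :
    colourSum x r (n + 1) (fun κ => h (κ 0) (κ (Fin.last _))) =
      colourSum x r n fun κ =>
        transfer x (fun c => if κ 0 ≠ c then h (κ 0) c else 0) (κ (Fin.last _)) := by
  rw [colourSum_succ x hr]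
  congr 1
  ext κ
  rw [transfer_apply_eq_sum]
  refine Finset.sum_congr rfl fun c _ => ?_
  have : (∀ i : Fin (n + 1), r i (n + 1) → κ i ≠ c) ↔ κ (Fin.last n) ≠ c ∧ κ 0 ≠ c := by
    refine ⟨fun h => ⟨h _ ((hn _).2 (Or.inl rfl)), h _ ((hn _).2 (Or.inr rfl))⟩, ?_⟩
    rintro ⟨h1, h2⟩ i hi
    rcases (hn _).1 hi with h | h
    · rwa [show i = Fin.last n from Fin.ext h]
    · rwa [show i = 0 from Fin.ext h]
  simp only [this, snoc_zero_eq, Fin.snoc_last, ite_and, mul_ite, mul_zero]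

theorem colourSum_triangle (hr : ∀ i j, r i j → i < j) {n : ℕ}
    (h1 : ∀ i, r i (n + 1) ↔ i = n) (h2 : ∀ i, r i (n + 2) ↔ i = n + 1 ∨ i = n) :
    colourSum x r (n + 2) (fun _ => 1) = colourSum x r n fun κ =>
      ∑ a, ∑ b, if κ (Fin.last n) ≠ a ∧ κ (Fin.last n) ≠ b ∧ a ≠ b then x a * x b else 0 := by
  rw [colourSum_succ x hr, colourSum_succ x hr]
  congr 1
  ext κ
  refine Finset.sum_congr rfl fun a _ => ?_
  have e1 : (∀ i : Fin (n + 1), r i (n + 1) → κ i ≠ a) ↔ κ (Fin.last n) ≠ a :=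
    ⟨fun h => h _ ((h1 _).2 rfl), fun h i hi => by
      rwa [show i = Fin.last n from Fin.ext ((h1 _).1 hi)]⟩
  have e2 (b : ι) : (∀ i : Fin (n + 2), r i (n + 1 + 1) →
      Fin.snoc (α := fun _ => ι) κ a i ≠ b) ↔ κ (Fin.last n) ≠ b ∧ a ≠ b := by
    constructor
    · intro h
      refine ⟨?_, ?_⟩
      · simpa using h (Fin.last n).castSucc ((h2 _).2 (Or.inr rfl))
      · simpa using h (Fin.last (n + 1)) ((h2 _).2 (Or.inl rfl))
    · rintro ⟨hb, hab⟩ i hi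
      rcases (h2 _).1 hi with h | h
      · rw [show i = Fin.last (n + 1) from Fin.ext h]
        simpa using hab
      · rw [show i = (Fin.last n).castSucc from Fin.ext h]
        simpa using hb
  simp only [e1, e2, mul_one, Finset.mul_sum, mul_ite, mul_zero]
  split_ifs with h <;> simp [h]

theorem colourSum_path_steps (hr : ∀ i j, r i j → i < j) (n t : ℕ)
    (hn : ∀ k < t, ∀ i, r i (n + k + 1) ↔ i = n + k) (h : ι → ι → A) :
    colourSum x r (n + t) (fun κ => h (κ 0) (κ (Fin.last _))) =
      colourSum x r n fun κ => (transfer x ^ t) (h (κ 0)) (κ (Fin.last _)) := by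
  induction t generalizing h with
  | zero => simp
  | succ t ih =>
    rw [← add_assoc, colourSum_path_step x hr (hn t (by omega)),
      ih (fun k hk => hn k (by omega)) fun a => transfer x (h a)]
    simp only [← Module.End.mul_apply, ← pow_succ]

omit [DecidableEq ι] in
theorem colourSum_zero (hr : ∀ i j, r i j → i < j) (h : ι → ι → A) :
    colourSum x r 0 (fun κ => h (κ 0) (κ (Fin.last _))) = ∑ a, x a * h a a := by
  rw [colourSum, ← (Equiv.funUnique (Fin 1) ι).symm.sum_comp]
  refine Finset.sum_congr rfl fun a _ => ?_
  rw [if_pos fun i j hij => absurd (hr _ _ hij) (by omega)]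
  simp

/-- The edges `(i, j)`, `i < j`, of the dumbbell made of a cycle on `0, …, m`, a path, and
a triangle on `m + t, m + t + 1, m + t + 2`. -/
def dumbbellRel (m t i j : ℕ) : Prop :=
  j = i + 1 ∨ (i = 0 ∧ j = m) ∨ (i = m + t ∧ j = m + t + 2)

theorem colourSum_dumbbell (m t : ℕ) (hm : 2 ≤ m) :
    colourSum x (dumbbellRel m t) (m + t + 2) (fun _ => 1) =
      dumbbellSeq (elemPoly x) (m + 1) (m + 1 + t + 2) := by
  have hr (i j : ℕ) (h : dumbbellRel m t i j) : i < j := by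
    unfold dumbbellRel at h; omega
  obtain ⟨m, rfl⟩ : ∃ k, m = k + 1 := ⟨m - 1, by omega⟩
  rw [colourSum_triangle x hr (by unfold dumbbellRel; omega) (by unfold dumbbellRel; omega)]
  simp only [sum_triangle]
  rw [colourSum_path_steps x hr (m + 1) t (by unfold dumbbellRel; omega)
    fun _ c => 2 * (transfer x ^ 2) 1 c - 2 * elemPoly x 2]
  have hτ : (fun c => 2 * (transfer x ^ 2) 1 c - 2 * elemPoly x 2) =
      (2 : A) • (transfer x ^ 2) 1 - (2 * elemPoly x 2) • (1 : ι → A) := by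
    ext c; simp
  rw [hτ]
  set g : ι → A := (transfer x ^ t)
    ((2 : A) • (transfer x ^ 2) 1 - (2 * elemPoly x 2) • (1 : ι → A)) with hg
  rw [colourSum_chord_step x hr (by unfold dumbbellRel; omega) fun _ => g]
  have hpath := colourSum_path_steps x hr 0 m (by unfold dumbbellRel; omega)
    fun a => transfer x fun c => if a ≠ c then g c else 0
  rw [zero_add] at hpath
  rw [hpath, colourSum_zero x hr fun a =>
    (transfer x ^ m) (transfer x fun c => if a ≠ c then g c else 0)]
  simp only [← Module.End.mul_apply, ← pow_succ]
  rw [sum_mul_transfer_pow_ne, ← tadpolePoly_sub_eq_dumbbellSeq, hg, map_sub, map_smul, map_smul,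
    ← Module.End.mul_apply, ← pow_add, tadpolePoly, tadpolePoly, mul_sub, ← mul_assoc,
    Finset.mul_sum, Finset.mul_sum, ← Finset.sum_sub_distrib]
  refine Finset.sum_congr rfl fun a _ => ?_
  simp only [Pi.sub_apply, Pi.smul_apply, smul_eq_mul]
  ring

end Colourings

section Truncation

/-- The power series all of whose monomials involve a variable of index at least `K`. -/
def tailIdeal (K : ℕ) : Ideal (MvPowerSeries ℕ ℚ) where
  carrier := {f | ∀ d : ℕ →₀ ℕ, d.support ⊆ Finset.range K → MvPowerSeries.coeff d f = 0}
  add_mem' hf hg d hd := by rw [map_add, hf d hd, hg d hd, add_zero]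
  zero_mem' d _ := map_zero _
  smul_mem' g f hf d hd := by
    rw [smul_eq_mul, MvPowerSeries.coeff_mul]
    refine Finset.sum_eq_zero fun p hp => ?_
    have hp := Finset.HasAntidiagonal.mem_antidiagonal.1 hp
    rw [hf p.2 (subset_trans (Finsupp.support_mono (hp ▸ le_add_self)) hd), mul_zero]

theorem mk_tailIdeal_eq {K : ℕ} {f g : MvPowerSeries ℕ ℚ} :
    Ideal.Quotient.mk (tailIdeal K) f = Ideal.Quotient.mk (tailIdeal K) g ↔
      ∀ d : ℕ →₀ ℕ, d.support ⊆ Finset.range K →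
        MvPowerSeries.coeff d f = MvPowerSeries.coeff d g := by
  rw [Ideal.Quotient.eq]
  refine forall₂_congr fun d _ => ?_
  rw [map_sub, sub_eq_zero]

theorem eq_of_forall_mk_tailIdeal_eq {f g : MvPowerSeries ℕ ℚ}
    (h : ∀ K, Ideal.Quotient.mk (tailIdeal K) f = Ideal.Quotient.mk (tailIdeal K) g) : f = g := by
  ext d
  refine mk_tailIdeal_eq.1 (h (d.support.sup id + 1)) d fun i hi => ?_
  exact Finset.mem_range.2 (Nat.lt_succ_of_le (Finset.le_sup (f := id) hi))

/-- The variables `x_0, …, x_{K-1}`. -/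
noncomputable def firstVars (K : ℕ) (a : Fin K) : MvPowerSeries ℕ ℚ := MvPowerSeries.X (a : ℕ)

theorem prod_firstVars {K : ℕ} {V : Type*} (s : Finset V) (κ : V → Fin K) :
    ∏ v ∈ s, firstVars K (κ v) =
      MvPowerSeries.monomial (∑ v ∈ s, Finsupp.single (κ v : ℕ) 1) 1 := by
  classical
  induction s using Finset.induction_on with
  | empty => simp
  | insert v s hv ih =>
    rw [Finset.prod_insert hv, Finset.sum_insert hv, ih, firstVars, MvPowerSeries.X_def,
      MvPowerSeries.monomial_mul_monomial, one_mul]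

theorem mk_esym (K k : ℕ) :
    Ideal.Quotient.mk (tailIdeal K) (esym k) =
      Ideal.Quotient.mk (tailIdeal K) (elemPoly (firstVars K) k) := by
  classical
  rw [mk_tailIdeal_eq]
  intro d hd
  have hdK (i : ℕ) (hi : d i ≠ 0) : i < K :=
    Finset.mem_range.1 (hd (Finsupp.mem_support_iff.2 hi))
  have happ (t : Finset (Fin K)) (i : ℕ) :
      (∑ a ∈ t, Finsupp.single (a : ℕ) 1) i = if ∃ a ∈ t, (a : ℕ) = i then 1 else 0 := by
    rw [Finsupp.finsetSum_apply]
    split_ifs with h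
    · obtain ⟨a, ha, rfl⟩ := h
      rw [Finset.sum_eq_single_of_mem a ha, Finsupp.single_eq_same]
      intro b _ hb
      exact Finsupp.single_eq_of_ne fun h => hb (Fin.ext h.symm)
    · refine Finset.sum_eq_zero fun a ha => Finsupp.single_eq_of_ne fun h' => h ⟨a, ha, h'.symm⟩
  have hdeg (t : Finset (Fin K)) (ht : d = ∑ a ∈ t, Finsupp.single (a : ℕ) 1) :
      (d.sum fun _ v => v) = t.card := by
    change d.degree = _
    rw [ht, map_sum]
    simp
  rw [elemPoly, map_sum]
  have hprod (t : Finset (Fin K)) : ∏ a ∈ t, firstVars K a =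
      MvPowerSeries.monomial (∑ a ∈ t, Finsupp.single (a : ℕ) 1) 1 := prod_firstVars t id
  simp only [hprod, MvPowerSeries.coeff_monomial]
  rw [MvPowerSeries.coeff_apply, esym]
  by_cases h : ∀ i ∈ d.support, d i = 1
  · have ht : d = ∑ a ∈ Finset.univ.filter (fun a : Fin K => d a ≠ 0),
        Finsupp.single (a : ℕ) 1 := by
      ext i
      rw [happ]
      split_ifs with h'
      · obtain ⟨a, ha, rfl⟩ := h'
        exact h _ (by simpa using ha)
      · by_contra hi
        exact h' ⟨⟨i, hdK i hi⟩, by simpa using hi, rfl⟩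
    have huniq (t : Finset (Fin K)) : d = ∑ a ∈ t, Finsupp.single (a : ℕ) 1 ↔
        t = Finset.univ.filter (fun a : Fin K => d a ≠ 0) := by
      refine ⟨fun h => ?_, fun h => h ▸ ht⟩
      ext a
      have := happ t a
      rw [← h] at this
      simp [this, Fin.val_inj]
    simp only [huniq]
    rw [Finset.sum_ite_eq', hdeg _ ht]
    simp only [and_iff_right h]
    simp
  · rw [if_neg fun h' => h h'.1, Finset.sum_eq_zero]
    intro t _
    rw [if_neg]
    intro ht
    refine h fun i hi => ?_
    have hi := Finsupp.mem_support_iff.1 hi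
    rw [ht, happ] at hi ⊢
    simpa using hi

open scoped Classical in
theorem mk_csf {V : Type} [Fintype V] (G : SimpleGraph V) (K : ℕ) :
    Ideal.Quotient.mk (tailIdeal K) (csf G) =
      Ideal.Quotient.mk (tailIdeal K) (∑ κ : V → Fin K,
        if ∀ u v, G.Adj u v → κ u ≠ κ v then ∏ v, firstVars K (κ v) else 0) := by
  rw [mk_tailIdeal_eq]
  intro d hd
  have hcount (κ : V → ℕ) (i : ℕ) :
      (∑ v, Finsupp.single (κ v) 1) i = Nat.card {v : V // κ v = i} := by
    rw [Finsupp.finsetSum_apply, Nat.card_eq_fintype_card, Fintype.card_subtype,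
      Finset.card_filter]
    simp [Finsupp.single_apply]
  have hval (κ : V → Fin K) : d = ∑ v, Finsupp.single (κ v : ℕ) 1 ↔
      ∀ i, Nat.card {v : V // (κ v : ℕ) = i} = d i := by
    rw [DFunLike.ext_iff]
    refine forall_congr' fun i => ?_
    rw [hcount fun v => (κ v : ℕ), eq_comm]
  rw [map_sum]
  simp only [apply_ite, map_zero, prod_firstVars, MvPowerSeries.coeff_monomial, hval, ← ite_and]
  rw [Finset.sum_boole, MvPowerSeries.coeff_apply, csf, Nat.cast_inj,
    ← Fintype.card_subtype, ← Nat.card_eq_fintype_card]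
  symm
  refine Nat.card_eq_of_bijective (fun κ => ⟨fun v => (κ.1 v : ℕ), fun u v huv h =>
    κ.2.1 u v huv (Fin.ext h), κ.2.2⟩) ⟨fun κ κ' h => ?_, fun κ => ?_⟩
  · ext v
    exact congrFun (congrArg Subtype.val h) v
  · have hlt (v : V) : κ.1 v < K := by
      refine Finset.mem_range.1 (hd (Finsupp.mem_support_iff.2 ?_))
      rw [← κ.2.2]
      exact (Nat.card_pos_iff.2 ⟨⟨v, rfl⟩, inferInstance⟩).ne'
    refine ⟨⟨fun v => ⟨κ.1 v, hlt v⟩, fun u v huv h => ?_, κ.2.2⟩, rfl⟩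
    exact κ.2.1 u v huv (congrArg Fin.val h)

theorem csf_eq_dumbbellSeq {N m t : ℕ} (hm : 2 ≤ m) (hN : N = m + t + 2 + 1)
    (G : SimpleGraph (Fin N))
    (hG : ∀ i j, G.Adj i j ↔ dumbbellRel m t i j ∨ dumbbellRel m t j i) :
    csf G = dumbbellSeq esym (m + 1) (m + 1 + t + 2) := by
  subst hN
  refine eq_of_forall_mk_tailIdeal_eq fun K => ?_
  rw [mk_csf, map_dumbbellSeq]
  simp only [mk_esym]
  rw [← map_dumbbellSeq, ← colourSum_dumbbell _ _ _ hm, colourSum]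
  congr 1
  refine Finset.sum_congr (Finset.ext fun _ => by simp) fun κ _ => ?_
  rw [mul_one]
  congr 1
  simp only [hG, eq_iff_iff]
  exact ⟨fun h i j hij => h i j (Or.inl hij), fun h i j hij =>
    hij.elim (h i j) fun hji => (h j i hji).symm⟩

theorem csf_dumbbell (m : ℕ) (l : ℤ) (hm : 3 ≤ m) :
    csf (dumbbell m 3 l) = dumbbellSeq esym m (m + (l + 1).toNat + 2) := by
  obtain ⟨m, rfl⟩ : ∃ k, m = k + 1 := ⟨m - 1, by omega⟩
  refine csf_eq_dumbbellSeq (by omega) (by omega) _ fun i j => ?_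
  simp only [dumbbell, dumbbellAux, dumbbellRel, SimpleGraph.fromRel_adj, ne_eq, Fin.ext_iff]
  omega

end Truncation

section Positivity

theorem EPositive.zero : EPositive 0 := ⟨0, by simp, by simp, by simp⟩

theorem EPositive.add {f g : MvPowerSeries ℕ ℚ} (hf : EPositive f) (hg : EPositive g) :
    EPositive (f + g) := by
  classical
  obtain ⟨c, hc, hc0, rfl⟩ := hf
  obtain ⟨c', hc', hc0', rfl⟩ := hg
  refine ⟨c + c', fun μ => add_nonneg (hc μ) (hc' μ), fun μ hμ => ?_, ?_⟩
  · rcases Finset.mem_union.1 (Finsupp.support_add hμ) with h | h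
    · exact hc0 μ h
    · exact hc0' μ h
  · rw [Finsupp.sum_add_index'] <;> simp [add_smul]

theorem EPositive.sum {ι : Type*} {s : Finset ι} {f : ι → MvPowerSeries ℕ ℚ}
    (h : ∀ i ∈ s, EPositive (f i)) : EPositive (∑ i ∈ s, f i) :=
  Finset.sum_induction f EPositive (fun _ _ => EPositive.add) EPositive.zero h

theorem EPositive.smul_esymM {a : ℚ} (ha : 0 ≤ a) {μ : Multiset ℕ} (hμ : 0 ∉ μ) :
    EPositive (a • esymM μ) := by
  classical
  refine ⟨Finsupp.single μ a, fun ν => ?_, fun ν hν => ?_, ?_⟩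
  · rw [Finsupp.single_apply]
    split_ifs <;> simp [ha]
  · rwa [Finset.mem_singleton.1 (Finsupp.support_single_subset hν)]
  · rw [Finsupp.sum_single_index]
    exact zero_smul _ _

theorem EPositive.one : EPositive 1 := by
  simpa [esymM] using EPositive.smul_esymM zero_le_one (Multiset.notMem_zero 0)

theorem EPositive.natCast_mul (n : ℕ) {f : MvPowerSeries ℕ ℚ} (hf : EPositive f) :
    EPositive (n * f) := by
  rw [← nsmul_eq_mul, ← Finset.card_range n, ← Finset.sum_const]
  exact EPositive.sum fun _ _ => hf

theorem EPositive.natCast (n : ℕ) : EPositive n := by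
  simpa using EPositive.one.natCast_mul n

theorem EPositive.esym_mul {k : ℕ} (hk : k ≠ 0) {f : MvPowerSeries ℕ ℚ} (hf : EPositive f) :
    EPositive (esym k * f) := by
  obtain ⟨c, hc, hc0, rfl⟩ := hf
  rw [Finsupp.sum, Finset.mul_sum]
  refine EPositive.sum fun μ hμ => ?_
  have h : esym k * c μ • esymM μ = c μ • esymM (k ::ₘ μ) := by
    rw [mul_smul_comm, esymM, esymM, Multiset.map_cons, Multiset.prod_cons]
  rw [h]
  refine EPositive.smul_esymM (hc μ) fun h0 => ?_
  rcases Multiset.mem_cons.1 h0 with h0 | h0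
  · exact hk h0.symm
  · exact hc0 μ hμ h0

theorem EPositive.invSeq (n : ℕ) : EPositive (invSeq esym n) := by
  induction n using Nat.strong_induction_on with
  | _ n ih =>
    cases n with
    | zero => rw [_root_.invSeq]; exact EPositive.one
    | succ n =>
      rw [_root_.invSeq]
      exact EPositive.sum fun j _ =>
        ((ih (n - j) (by omega)).esym_mul (Nat.succ_ne_zero _)).natCast_mul _

theorem EPositive.truncSeq (m n : ℕ) : EPositive (truncSeq esym m n) := by
  induction n using Nat.strong_induction_on with
  | _ n ih =>
    cases n with
    | zero => rw [_root_.truncSeq]; exact EPositive.natCast _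
    | succ n =>
      rw [_root_.truncSeq]
      split_ifs
      · exact (EPositive.invSeq _).natCast_mul _
      · exact EPositive.sum fun j _ =>
          ((ih (n - j) (by omega)).esym_mul (Nat.succ_ne_zero _)).natCast_mul _

theorem EPositive.triSeq_mul (n : ℕ) {f : MvPowerSeries ℕ ℚ} (hf : EPositive f) :
    EPositive (triSeq esym n * f) := by
  rcases n with _ | _ | _ | _ | k
  · simpa [triSeq] using EPositive.zero
  · simpa [triSeq] using EPositive.zero
  · simpa [triSeq] using EPositive.zero
  · rw [triSeq, mul_assoc]
    exact_mod_cast (hf.esym_mul (k := 3) (by omega)).natCast_mul 3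
  · simp only [triSeq, add_mul, mul_assoc]
    exact (((hf.esym_mul (by omega)).natCast_mul _).add
      (((hf.esym_mul (by omega)).esym_mul one_ne_zero).natCast_mul _)).add
      (((hf.esym_mul (by omega)).esym_mul two_ne_zero).natCast_mul _)

end Positivity

/-- For every `m ≥ 3` and `l ≥ -1` (in particular for all `l ≥ 2` and also
for `l ∈ {-1, 0, 1}`), the dumbbell `D(m, l, 3)` is `e`-positive. -/
theorem dumbbell_triangle_ePositive (m : ℕ) (l : ℤ) (hm : 3 ≤ m) (hl : -1 ≤ l) :
    EPositive (csf (dumbbell m 3 l)) := by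
  rw [csf_dumbbell m l hm, dumbbellSeq]
  have h : EPositive (∑ p ∈ Finset.HasAntidiagonal.antidiagonal (m + (l + 1).toNat + 2),
      triSeq esym p.1 * truncSeq esym m p.2) :=
    EPositive.sum fun p _ => (EPositive.truncSeq m p.2).triSeq_mul p.1
  simpa only [Nat.cast_ofNat] using h.natCast_mul 2
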